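/- arXiv:1012.0297 — 15 statements merged into one kernel-verified Lean document; each statement's English description precedes it below -/
import Mathlib

section
/- Let A₀, A₁, B₀, B₁ ∈ ℝ with A₁ ≠ 0 and B₁ ≠ 0, let U : ℝ → ℝ be smooth with U'(s) ≠ 0 for all s ∈ ℝ, let f, g : ℝ × ℝ → ℝ be smooth, and let u be a solution of E(f,g). Define v(t,x) := U(u((t−A₀)/A₁, (x−B₀)/B₁)). Then for every (t,x) ∈ ℝ², writing t̂ = (t−A₀)/A₁, x̂ = (x−B₀)/B₁ and w = u(t̂,x̂), one has ∂v/∂t(t,x) = [(B₁²/(A₁·U'(w)))·(f(x̂,w) − (U''(w)/U'(w))·g(x̂,w))]·(∂v/∂x(t,x))² + [(B₁²/A₁)·g(x̂,w)]·(∂²v/∂x²(t,x)). (This is the statement that every transformation t̃ = A₁t+A₀, x̃ = B₁x+B₀, ũ = U(u), f̃ = (B₁²/(A₁U_u))(f − (U_{uu}/U_u)g), g̃ = (B₁²/A₁)g of the equivalence group G∼ maps solutions of E(f,g) to solutions of E(f̃,g̃).) -/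
/-- A smooth solution of the generalized diffusion equation `E(f,g)`:
`u_t = f(x,u) u_x² + g(x,u) u_{xx}`. -/
def IsSol (f g u : ℝ → ℝ → ℝ) : Prop :=
  ContDiff ℝ (⊤ : ℕ∞) (fun p : ℝ × ℝ => u p.1 p.2) ∧
  ∀ t x : ℝ,
    deriv (fun s => u s x) t
      = f x (u t x) * (deriv (fun y => u t y) x) ^ 2
        + g x (u t x) * deriv (deriv (fun y => u t y)) x

/-- First derivative of `U ∘ φ` after an affine change of variable. -/
theorem hasDerivAt_comp_affine {U φ : ℝ → ℝ} (hU : Differentiable ℝ U)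
    (hφ : Differentiable ℝ φ) (a b x : ℝ) :
    HasDerivAt (fun y => U (φ ((y - b) / a)))
      (deriv U (φ ((x - b) / a)) * (deriv φ ((x - b) / a) / a)) x := by
  have haff : HasDerivAt (fun y : ℝ => (y - b) / a) (1 / a) x :=
    ((hasDerivAt_id x).sub_const b).div_const a
  have hinner : HasDerivAt (fun y => φ ((y - b) / a)) (deriv φ ((x - b) / a) * (1 / a)) x :=
    (hφ ((x - b) / a)).hasDerivAt.comp x haff
  rw [← mul_one_div (deriv φ _) a]
  exact (hU (φ ((x - b) / a))).hasDerivAt.comp x hinner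

/-- Second derivative of `U ∘ φ` after an affine change of variable. -/
theorem deriv_deriv_comp_affine {U φ : ℝ → ℝ} (hU : ContDiff ℝ 2 U) (hφ : ContDiff ℝ 2 φ)
    (a b x : ℝ) :
    deriv (deriv (fun y => U (φ ((y - b) / a)))) x
      = deriv (deriv U) (φ ((x - b) / a)) * (deriv φ ((x - b) / a) / a) ^ 2
        + deriv U (φ ((x - b) / a)) * (deriv (deriv φ) ((x - b) / a) / a ^ 2) := by
  have hU₁ : Differentiable ℝ U := hU.differentiable two_ne_zero
  have hφ₁ : Differentiable ℝ φ := hφ.differentiable two_ne_zero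
  have hU₂ : Differentiable ℝ (deriv U) := hU.differentiable_deriv_two
  have hφ₂ : Differentiable ℝ (deriv φ) := hφ.differentiable_deriv_two
  have hderiv : deriv (fun y => U (φ ((y - b) / a)))
      = fun y => deriv U (φ ((y - b) / a)) * (deriv φ ((y - b) / a) / a) :=
    funext fun y => (hasDerivAt_comp_affine hU₁ hφ₁ a b y).deriv
  have houter := hasDerivAt_comp_affine hU₂ hφ₁ a b x
  have hinner := (hasDerivAt_comp_affine differentiable_id hφ₂ a b x).div_const a
  simp only [deriv_id, id, one_mul] at hinner
  rw [hderiv, (houter.fun_mul hinner).deriv]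
  ring

/-- Every transformation `t̃ = A₁t+A₀`, `x̃ = B₁x+B₀`, `ũ = U(u)` of the equivalence group
maps solutions of `E(f,g)` to solutions of `E(f̃,g̃)` with
`f̃ = (B₁²/(A₁U_u))(f − (U_{uu}/U_u)g)` and `g̃ = (B₁²/A₁)g`. -/
theorem equivalence_transformation_maps_solutions
    (A₀ A₁ B₀ B₁ : ℝ) (hA₁ : A₁ ≠ 0) (hB₁ : B₁ ≠ 0)
    (U : ℝ → ℝ) (hU : ContDiff ℝ (⊤ : ℕ∞) U) (hU' : ∀ s : ℝ, deriv U s ≠ 0)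
    (f g : ℝ → ℝ → ℝ)
    (hf : ContDiff ℝ (⊤ : ℕ∞) (fun p : ℝ × ℝ => f p.1 p.2))
    (hg : ContDiff ℝ (⊤ : ℕ∞) (fun p : ℝ × ℝ => g p.1 p.2))
    (u : ℝ → ℝ → ℝ) (hu : IsSol f g u)
    (v : ℝ → ℝ → ℝ)
    (hv : ∀ t x : ℝ, v t x = U (u ((t - A₀) / A₁) ((x - B₀) / B₁))) :
    ∀ t x : ℝ,
      deriv (fun s => v s x) t
        = (B₁ ^ 2 / (A₁ * deriv U (u ((t - A₀) / A₁) ((x - B₀) / B₁))))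
            * (f ((x - B₀) / B₁) (u ((t - A₀) / A₁) ((x - B₀) / B₁))
                - (deriv (deriv U) (u ((t - A₀) / A₁) ((x - B₀) / B₁))
                    / deriv U (u ((t - A₀) / A₁) ((x - B₀) / B₁)))
                  * g ((x - B₀) / B₁) (u ((t - A₀) / A₁) ((x - B₀) / B₁)))
            * (deriv (fun y => v t y) x) ^ 2
          + (B₁ ^ 2 / A₁) * g ((x - B₀) / B₁) (u ((t - A₀) / A₁) ((x - B₀) / B₁))
            * deriv (deriv (fun y => v t y)) x := by
  intro t x
  obtain ⟨hu_smooth, hu_eq⟩ := hu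
  have hU₂ : ContDiff ℝ 2 U := contDiff_infty.mp hU 2
  have hu₂ : ContDiff ℝ 2 (fun p : ℝ × ℝ => u p.1 p.2) :=
    contDiff_infty.mp hu_smooth 2
  have hU₁ : Differentiable ℝ U := hU₂.differentiable two_ne_zero
  have hut (y : ℝ) : ContDiff ℝ 2 (fun s => u s y) :=
    hu₂.comp (contDiff_id.prodMk contDiff_const)
  have hux (s : ℝ) : ContDiff ℝ 2 (fun y => u s y) :=
    hu₂.comp (contDiff_const.prodMk contDiff_id)
  have hvt := (hasDerivAt_comp_affine hU₁
    ((hut ((x - B₀) / B₁)).differentiable two_ne_zero) A₁ A₀ t).deriv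
  have hvx := (hasDerivAt_comp_affine hU₁
    ((hux ((t - A₀) / A₁)).differentiable two_ne_zero) B₁ B₀ x).deriv
  have hvxx := deriv_deriv_comp_affine hU₂ (hux ((t - A₀) / A₁)) B₁ B₀ x
  simp only [hv]
  rw [hvt, hvx, hvxx, hu_eq]
  have hne := hU' (u ((t - A₀) / A₁) ((x - B₀) / B₁))
  generalize (t - A₀) / A₁ = τ at *
  generalize (x - B₀) / B₁ = ξ at *
  field_simp
  ring
end

section
/- Let c ∈ ℝ with c ≠ 0, let g : ℝ × ℝ → ℝ be smooth, and let u : ℝ × ℝ → ℝ be smooth and satisfy ∂u/∂t(t,x) = c·g(x,u(t,x))·(∂u/∂x(t,x))² + g(x,u(t,x))·(∂²u/∂x²(t,x)) for all (t,x) ∈ ℝ² (i.e., u is a solution of E(f,g) with f = c·g). Then v(t,x) := exp(c·u(t,x)) satisfies ∂v/∂t(t,x) = g(x, u(t,x))·(∂²v/∂x²(t,x)) for all (t,x) ∈ ℝ²; that is, the point transformation ũ = e^{cu} maps the equation to an equation of the same form with f̃ = 0. -/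
/-- The chain rule for the second derivative of `exp (c * w)`. -/
theorem deriv_deriv_exp_const_mul {w : ℝ → ℝ} (c : ℝ) (hw : ContDiff ℝ 2 w) (x : ℝ) :
    deriv (deriv fun y => Real.exp (c * w y)) x
      = c * Real.exp (c * w x) * (c * deriv w x ^ 2 + deriv (deriv w) x) := by
  have hd : Differentiable ℝ w := hw.differentiable (by norm_num)
  have hdd : Differentiable ℝ (deriv w) := by
    have h : ContDiff ℝ (1 + 1) w := by simpa only [one_add_one_eq_two] using hw
    exact (contDiff_succ_iff_deriv.1 h).2.2.differentiable (by norm_num)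
  have hexp (y : ℝ) : HasDerivAt (fun y => Real.exp (c * w y))
      (Real.exp (c * w y) * (c * deriv w y)) y :=
    ((hd y).hasDerivAt.const_mul c).exp
  rw [funext fun y => (hexp y).deriv,
    ((hexp x).fun_mul ((hdd x).hasDerivAt.const_mul c)).deriv]
  ring

/-- If `u` solves `u_t = c·g(x,u)·u_x² + g(x,u)·u_{xx}` (the case `f = c·g`), then
`v = exp(c·u)` solves `v_t = g(x,u)·v_{xx}`; i.e. the transformation `ũ = e^{cu}` maps
the equation to one of the same form with `f̃ = 0`. -/
theorem f_proportional_to_g_linearizes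
    (c : ℝ) (hc : c ≠ 0)
    (g : ℝ → ℝ → ℝ) (hg : ContDiff ℝ (⊤ : ℕ∞) (fun p : ℝ × ℝ => g p.1 p.2))
    (u : ℝ → ℝ → ℝ) (hu : ContDiff ℝ (⊤ : ℕ∞) (fun p : ℝ × ℝ => u p.1 p.2))
    (hpde : ∀ t x : ℝ,
      deriv (fun s => u s x) t
        = c * g x (u t x) * (deriv (fun y => u t y) x) ^ 2
          + g x (u t x) * deriv (deriv (fun y => u t y)) x) :
    ∀ t x : ℝ,
      deriv (fun s => Real.exp (c * u s x)) t
        = g x (u t x) * deriv (deriv (fun y => Real.exp (c * u t y))) x := by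
  intro t x
  have hut : Differentiable ℝ fun s => u s x :=
    (hu.comp (contDiff_id.prodMk contDiff_const)).differentiable (by simp)
  have hux : ContDiff ℝ 2 fun y => u t y :=
    contDiff_infty.1 (hu.comp (contDiff_const.prodMk contDiff_id)) 2
  rw [((hut t).hasDerivAt.const_mul c).exp.deriv, deriv_deriv_exp_const_mul c hux, hpde]
  ring
end

section
/- Let h¹, h² : ℝ → ℝ be smooth, and on ℝ⁵ with points written p = (t,x,u,f,g) define the vector fields 𝒢(h)(p) := (0, 0, h(u), −(h'(u)·f + h''(u)·g), 0) for any smooth h : ℝ → ℝ. Then the Lie bracket of vector fields satisfies [𝒢(h¹), 𝒢(h²)] = 𝒢(h¹·(h²)' − h²·(h¹)'), i.e., for all p ∈ ℝ⁵, [𝒢(h¹),𝒢(h²)](p) = (0, 0, k(u), −(k'(u)·f + k''(u)·g), 0) where k := h¹·(h²)' − h²·(h¹)'. -/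
theorem ContDiff.deriv_smooth {h : ℝ → ℝ} (hh : ContDiff ℝ (⊤ : ℕ∞) h) :
    ContDiff ℝ (⊤ : ℕ∞) (deriv h) :=
  (contDiff_infty_iff_deriv.1 hh).2

theorem fderiv_prolongation_apply {h : ℝ → ℝ} (hh : ContDiff ℝ (⊤ : ℕ∞) h) (p v : Fin 5 → ℝ) :
    fderiv ℝ (fun p : Fin 5 → ℝ =>
      ![0, 0, h (p 2), -(deriv h (p 2) * p 3 + deriv (deriv h) (p 2) * p 4), 0]) p v
      = ![0, 0, deriv h (p 2) * v 2,
        -(deriv (deriv h) (p 2) * v 2 * p 3 + deriv h (p 2) * v 3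
          + (deriv (deriv (deriv h)) (p 2) * v 2 * p 4 + deriv (deriv h) (p 2) * v 4)), 0] := by
  have proj (i : Fin 5) : HasFDerivAt (fun q : Fin 5 → ℝ => q i)
      (ContinuousLinearMap.proj (R := ℝ) (φ := fun _ : Fin 5 => ℝ) i) p :=
    hasFDerivAt_apply i p
  have comp {φ : ℝ → ℝ} (hφ : ContDiff ℝ (⊤ : ℕ∞) φ) :
      HasFDerivAt (fun q : Fin 5 → ℝ => φ (q 2))
        (deriv φ (p 2) • ContinuousLinearMap.proj (R := ℝ) (φ := fun _ : Fin 5 => ℝ) 2) p :=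
    (hφ.differentiable (by simp) (p 2)).hasDerivAt.comp_hasFDerivAt p (proj 2)
  obtain ⟨L, hL, hLv⟩ : ∃ L : (Fin 5 → ℝ) →L[ℝ] ℝ, HasFDerivAt (fun p : Fin 5 → ℝ =>
      -(deriv h (p 2) * p 3 + deriv (deriv h) (p 2) * p 4)) L p ∧
      L v = -(deriv (deriv h) (p 2) * v 2 * p 3 + deriv h (p 2) * v 3
          + (deriv (deriv (deriv h)) (p 2) * v 2 * p 4 + deriv (deriv h) (p 2) * v 4)) := by
    refine ⟨_, (((comp hh.deriv_smooth).mul (proj 3)).add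
      ((comp hh.deriv_smooth.deriv_smooth).mul (proj 4))).neg, ?_⟩
    simp
    ring
  have hzero := hasFDerivAt_const (𝕜 := ℝ) (0 : ℝ) p
  have total : HasFDerivAt (fun p : Fin 5 → ℝ =>
      ![0, 0, h (p 2), -(deriv h (p 2) * p 3 + deriv (deriv h) (p 2) * p 4), 0])
      (ContinuousLinearMap.pi (![0, 0, deriv h (p 2) •
        ContinuousLinearMap.proj (R := ℝ) (φ := fun _ : Fin 5 => ℝ) 2, L, 0] :
          Fin 5 → (Fin 5 → ℝ) →L[ℝ] ℝ)) p := by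
    refine hasFDerivAt_pi'' fun i => ?_
    fin_cases i
    exacts [hzero, hzero, comp hh, hL, hzero]
  rw [total.fderiv]
  ext i
  fin_cases i <;> simp [hLv]

/-- On ℝ⁵ with coordinates `p = (t,x,u,f,g)` (here `p 0 = t, p 1 = x, p 2 = u, p 3 = f,
p 4 = g`), the vector fields `𝒢(h) = h(u)∂ᵤ − (h'(u)f + h''(u)g)∂_f` satisfy the
commutation relation `[𝒢(h¹), 𝒢(h²)] = 𝒢(h¹(h²)' − h²(h¹)')`. -/
theorem lieBracket_G_G
    (h₁ h₂ : ℝ → ℝ) (hh₁ : ContDiff ℝ (⊤ : ℕ∞) h₁) (hh₂ : ContDiff ℝ (⊤ : ℕ∞) h₂)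
    (G : (ℝ → ℝ) → (Fin 5 → ℝ) → (Fin 5 → ℝ))
    (hG : ∀ (h : ℝ → ℝ) (p : Fin 5 → ℝ),
      G h p = ![0, 0, h (p 2), -(deriv h (p 2) * p 3 + deriv (deriv h) (p 2) * p 4), 0])
    (k : ℝ → ℝ) (hk : k = fun s => h₁ s * deriv h₂ s - h₂ s * deriv h₁ s) :
    ∀ p : Fin 5 → ℝ,
      VectorField.lieBracket ℝ (G h₁) (G h₂) p
        = ![0, 0, k (p 2), -(deriv k (p 2) * p 3 + deriv (deriv k) (p 2) * p 4), 0] := by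
  have lie (p : Fin 5 → ℝ) : VectorField.lieBracket ℝ (G h₁) (G h₂) p
      = fderiv ℝ (G h₂) p (G h₁ p) - fderiv ℝ (G h₁) p (G h₂ p) := rfl
  have key (h : ℝ → ℝ) (hh : ContDiff ℝ (⊤ : ℕ∞) h) (p v : Fin 5 → ℝ) :
      fderiv ℝ (G h) p v = ![0, 0, deriv h (p 2) * v 2,
        -(deriv (deriv h) (p 2) * v 2 * p 3 + deriv h (p 2) * v 3
          + (deriv (deriv (deriv h)) (p 2) * v 2 * p 4 + deriv (deriv h) (p 2) * v 4)), 0] := by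
    rw [show G h = _ from funext (hG h)]
    exact fderiv_prolongation_apply hh p v
  have d {h : ℝ → ℝ} (hh : ContDiff ℝ (⊤ : ℕ∞) h) (s : ℝ) : HasDerivAt h (deriv h s) s :=
    (hh.differentiable (by simp) s).hasDerivAt
  have hk' : deriv k = fun s => h₁ s * deriv (deriv h₂) s - h₂ s * deriv (deriv h₁) s := by
    subst hk
    funext s
    refine (((d hh₁ s).mul (d hh₂.deriv_smooth s)).sub
      ((d hh₂ s).mul (d hh₁.deriv_smooth s))).deriv.trans ?_
    ring
  have hk'' (s : ℝ) : deriv (deriv k) s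
      = deriv h₁ s * deriv (deriv h₂) s + h₁ s * deriv (deriv (deriv h₂)) s
        - (deriv h₂ s * deriv (deriv h₁) s + h₂ s * deriv (deriv (deriv h₁)) s) := by
    rw [hk']
    exact (((d hh₁ s).mul (d hh₂.deriv_smooth.deriv_smooth s)).sub
      ((d hh₂ s).mul (d hh₁.deriv_smooth.deriv_smooth s))).deriv
  intro p
  rw [lie, key h₂ hh₂, key h₁ hh₁, hk'', hk', hk, hG, hG]
  ext i
  fin_cases i <;> simp <;> ring
end

section
/- Let a, δ, ε ∈ ℝ and let F, G : ℝ → ℝ be smooth. Define f(x,w) := F(w + δ·ln x)·x^{2−a} and g(x,w) := G(w + δ·ln x)·x^{2−a} for x > 0. If u is a solution of E(f,g) on ℝ × (0,∞), then v(t,x) := u(e^{−aε}·t, e^{−ε}·x) − δ·ε is also a solution of E(f,g) on ℝ × (0,∞). (Invariance under the one-parameter group generated by at∂ₜ + x∂ₓ − δ∂ᵤ.) -/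
/-- A smooth solution of the generalized diffusion equation `E(f,g)` on `ℝ × (0,∞)`:
`u_t = f(x,u) u_x² + g(x,u) u_{xx}` for all `t` and all `x > 0`. -/
def IsSolPos (f g u : ℝ → ℝ → ℝ) : Prop :=
  ContDiffOn ℝ (⊤ : ℕ∞) (fun p : ℝ × ℝ => u p.1 p.2) {p : ℝ × ℝ | 0 < p.2} ∧
  ∀ t x : ℝ, 0 < x →
    deriv (fun s => u s x) t
      = f x (u t x) * (deriv (fun y => u t y) x) ^ 2
        + g x (u t x) * deriv (deriv (fun y => u t y)) x

/-- Case 1 of Table 1: for `f = F(u + δ·ln x)·x^(2−a)`, `g = G(u + δ·ln x)·x^(2−a)` on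
`x > 0`, solutions are mapped to solutions by the one-parameter group generated by
`a·t·∂ₜ + x·∂ₓ − δ·∂ᵤ`. -/
theorem invariance_case1_1D
    (a δ ε : ℝ) (F G : ℝ → ℝ) (hF : ContDiff ℝ (⊤ : ℕ∞) F) (hG : ContDiff ℝ (⊤ : ℕ∞) G)
    (f g : ℝ → ℝ → ℝ)
    (hf : ∀ x w : ℝ, 0 < x → f x w = F (w + δ * Real.log x) * x ^ (2 - a))
    (hg : ∀ x w : ℝ, 0 < x → g x w = G (w + δ * Real.log x) * x ^ (2 - a))
    (u : ℝ → ℝ → ℝ) (hu : IsSolPos f g u) :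
    IsSolPos f g (fun t x => u (Real.exp (-(a * ε)) * t) (Real.exp (-ε) * x) - δ * ε) := by
  obtain ⟨hsmooth, heq⟩ := hu
  refine ⟨?_, fun t x hx => ?_⟩
  · have hscale : ContDiff ℝ (⊤ : ℕ∞)
        (fun p : ℝ × ℝ => (Real.exp (-(a * ε)) * p.1, Real.exp (-ε) * p.2)) := by
      fun_prop
    exact (hsmooth.comp hscale.contDiffOn
      fun p hp => mul_pos (Real.exp_pos _) hp).sub contDiffOn_const
  · have hy : 0 < Real.exp (-ε) * x := by positivity
    have ht : deriv (fun s => u (Real.exp (-(a * ε)) * s) (Real.exp (-ε) * x) - δ * ε) t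
        = Real.exp (-(a * ε)) *
          deriv (fun s => u s (Real.exp (-ε) * x)) (Real.exp (-(a * ε)) * t) := by
      rw [deriv_sub_const, deriv_comp_mul_left _ (fun s => u s (Real.exp (-ε) * x)), smul_eq_mul]
    have hx1 : deriv (fun y => u (Real.exp (-(a * ε)) * t) (Real.exp (-ε) * y) - δ * ε)
        = fun y => Real.exp (-ε) *
          deriv (fun z => u (Real.exp (-(a * ε)) * t) z) (Real.exp (-ε) * y) := by
      funext y
      rw [deriv_sub_const, deriv_comp_mul_left _ (fun z => u (Real.exp (-(a * ε)) * t) z),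
        smul_eq_mul]
    have hlog : Real.log (Real.exp (-ε) * x) = Real.log x - ε := by
      rw [Real.log_mul (Real.exp_ne_zero _) hx.ne', Real.log_exp]; ring
    have hpow : Real.exp (-(a * ε)) * (Real.exp (-ε) * x) ^ (2 - a)
        = x ^ (2 - a) * Real.exp (-ε) ^ 2 := by
      rw [Real.mul_rpow (Real.exp_pos _).le hx.le, ← Real.exp_mul, ← mul_assoc, ← Real.exp_add,
        ← Real.exp_nat_mul, mul_comm]
      congr 2
      push_cast
      ring
    have harg : ∀ w : ℝ, w + δ * (Real.log x - ε) = w - δ * ε + δ * Real.log x := by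
      intro w; ring
    simp only [ht, hx1]
    rw [deriv_const_mul_field, deriv_comp_mul_left, smul_eq_mul, heq _ _ hy, hf _ _ hy,
      hg _ _ hy, hf _ _ hx, hg _ _ hx, hlog, harg]
    set A := F (_ + _)
    set B := G (_ + _)
    set p := deriv (fun y => u (Real.exp (-(a * ε)) * t) y) (Real.exp (-ε) * x)
    set q := deriv (deriv (fun y => u (Real.exp (-(a * ε)) * t) y)) (Real.exp (-ε) * x)
    linear_combination (A * p ^ 2 + B * q) * hpow
end

section
/- Let δ, ε ∈ ℝ and let F, G : ℝ → ℝ be smooth. Define f(x,w) := F(w + δ·x)·e^{−x} and g(x,w) := G(w + δ·x)·e^{−x}. If u is a solution of E(f,g), then v(t,x) := u(e^{−ε}·t, x − ε) − δ·ε is also a solution of E(f,g). (Invariance under the one-parameter group generated by t∂ₜ + ∂ₓ − δ∂ᵤ.) -/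
/-- Case 2a of Table 1: for `f = F(u + δ·x)·exp(−x)`, `g = G(u + δ·x)·exp(−x)`,
solutions are mapped to solutions by the one-parameter group generated by
`t·∂ₜ + ∂ₓ − δ·∂ᵤ`. -/
theorem invariance_case2a_1D
    (δ ε : ℝ) (F G : ℝ → ℝ) (hF : ContDiff ℝ (⊤ : ℕ∞) F) (hG : ContDiff ℝ (⊤ : ℕ∞) G)
    (f g : ℝ → ℝ → ℝ)
    (hf : ∀ x w : ℝ, f x w = F (w + δ * x) * Real.exp (-x))
    (hg : ∀ x w : ℝ, g x w = G (w + δ * x) * Real.exp (-x))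
    (u : ℝ → ℝ → ℝ) (hu : IsSol f g u) :
    IsSol f g (fun t x => u (Real.exp (-ε) * t) (x - ε) - δ * ε) := by
  obtain ⟨hsmooth, heq⟩ := hu
  refine ⟨?_, fun t x => ?_⟩
  · have hmap : ContDiff ℝ (⊤ : ℕ∞) (fun p : ℝ × ℝ => (Real.exp (-ε) * p.1, p.2 - ε)) := by
      fun_prop
    exact (hsmooth.comp hmap).sub contDiff_const
  · have ht : deriv (fun s => u (Real.exp (-ε) * s) (x - ε) - δ * ε) t
        = Real.exp (-ε) * deriv (fun s => u s (x - ε)) (Real.exp (-ε) * t) := by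
      rw [deriv_sub_const]
      exact deriv_comp_mul_left (Real.exp (-ε)) (fun s => u s (x - ε)) t
    have hx : deriv (fun y => u (Real.exp (-ε) * t) (y - ε) - δ * ε)
        = fun y => deriv (fun z => u (Real.exp (-ε) * t) z) (y - ε) := by
      funext y
      rw [deriv_sub_const]
      exact deriv_comp_sub_const (fun z => u (Real.exp (-ε) * t) z) ε y
    have hxx : deriv (fun y => deriv (fun z => u (Real.exp (-ε) * t) z) (y - ε)) x
        = deriv (deriv (fun z => u (Real.exp (-ε) * t) z)) (x - ε) :=
      deriv_comp_sub_const (deriv (fun z => u (Real.exp (-ε) * t) z)) ε x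
    have harg : u (Real.exp (-ε) * t) (x - ε) - δ * ε + δ * x
        = u (Real.exp (-ε) * t) (x - ε) + δ * (x - ε) := by ring
    have hexp : Real.exp (-x) = Real.exp (-ε) * Real.exp (-(x - ε)) := by
      rw [← Real.exp_add]
      congr 1
      ring
    simp only [ht, hx, hxx, heq, hf, hg, harg, hexp]
    ring
end

section
/- Let ε ∈ ℝ and let F, G : ℝ → ℝ be smooth. Define f(x,w) := F(x)·e^{w} and g(x,w) := G(x)·e^{w}. If u is a solution of E(f,g), then v(t,x) := u(e^{−ε}·t, x) − ε is also a solution of E(f,g). (Invariance under the one-parameter group generated by t∂ₜ − ∂ᵤ.) -/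
/-- Case 2b of Table 1: for `f = F(x)·exp(u)`, `g = G(x)·exp(u)`, solutions are mapped
to solutions by the one-parameter group generated by `t·∂ₜ − ∂ᵤ`. -/
theorem invariance_case2b_1D
    (ε : ℝ) (F G : ℝ → ℝ) (hF : ContDiff ℝ (⊤ : ℕ∞) F) (hG : ContDiff ℝ (⊤ : ℕ∞) G)
    (f g : ℝ → ℝ → ℝ)
    (hf : ∀ x w : ℝ, f x w = F x * Real.exp w)
    (hg : ∀ x w : ℝ, g x w = G x * Real.exp w)
    (u : ℝ → ℝ → ℝ) (hu : IsSol f g u) :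
    IsSol f g (fun t x => u (Real.exp (-ε) * t) x - ε) := by
  obtain ⟨hsmooth, heq⟩ := hu
  refine ⟨?_, fun t x => ?_⟩
  · have hscale : ContDiff ℝ (⊤ : ℕ∞) (fun p : ℝ × ℝ => (Real.exp (-ε) * p.1, p.2)) := by
      fun_prop
    exact (hsmooth.comp hscale).sub contDiff_const
  · have htime : deriv (fun s => u (Real.exp (-ε) * s) x - ε) t
        = Real.exp (-ε) * deriv (fun s => u s x) (Real.exp (-ε) * t) := by
      rw [deriv_sub_const]
      exact deriv_comp_mul_left (Real.exp (-ε)) (fun s => u s x) t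
    have hspace : deriv (fun y => u (Real.exp (-ε) * t) y - ε)
        = deriv (fun y => u (Real.exp (-ε) * t) y) := by
      funext y
      rw [deriv_sub_const]
    simp only [htime, hspace, heq, hf, hg]
    rw [sub_eq_add_neg, Real.exp_add]
    ring
end

section
/- Let ε ∈ ℝ and let F, G : ℝ → ℝ be smooth. Define f(x,w) := F(w + x) and g(x,w) := G(w + x). If u is a solution of E(f,g), then v(t,x) := u(t, x − ε) − ε is also a solution of E(f,g). (Invariance under the one-parameter group generated by ∂ₓ − ∂ᵤ.) -/
/-- Case 3 of Table 1: for `f = F(u + x)`, `g = G(u + x)`, solutions are mapped to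
solutions by the one-parameter group generated by `∂ₓ − ∂ᵤ`. -/
theorem invariance_case3_1D
    (ε : ℝ) (F G : ℝ → ℝ) (hF : ContDiff ℝ (⊤ : ℕ∞) F) (hG : ContDiff ℝ (⊤ : ℕ∞) G)
    (f g : ℝ → ℝ → ℝ)
    (hf : ∀ x w : ℝ, f x w = F (w + x))
    (hg : ∀ x w : ℝ, g x w = G (w + x))
    (u : ℝ → ℝ → ℝ) (hu : IsSol f g u) :
    IsSol f g (fun t x => u t (x - ε) - ε) := by
  obtain ⟨hsmooth, heq⟩ := hu
  refine ⟨?_, fun t x => ?_⟩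
  · exact (hsmooth.comp (contDiff_fst.prodMk (contDiff_snd.sub contDiff_const))).sub
      contDiff_const
  · have hx : deriv (fun y => u t (y - ε) - ε) = fun y => deriv (fun z => u t z) (y - ε) := by
      funext y
      rw [deriv_sub_const, deriv_comp_sub_const (f := fun z => u t z)]
    have hxx : deriv (fun y => deriv (fun z => u t z) (y - ε)) x
        = deriv (deriv (fun z => u t z)) (x - ε) :=
      deriv_comp_sub_const ..
    have hsum : u t (x - ε) - ε + x = u t (x - ε) + (x - ε) := by ring
    have h := heq t (x - ε)
    rw [hf, hg] at h
    simp only [hx, hxx, hf, hg, hsum]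
    rw [deriv_sub_const]
    exact h
end

section
/- Let d, c₁, c₂, ε ∈ ℝ. Define f(x,w) := c₁·e^{w}·x^{2+d} and g(x,w) := c₂·e^{w}·x^{2+d} for x > 0. If u is a solution of E(f,g) on ℝ × (0,∞), then both v₁(t,x) := u(t, e^{−ε}·x) − d·ε and v₂(t,x) := u(e^{−ε}·t, x) − ε are solutions of E(f,g) on ℝ × (0,∞). (Invariance under the one-parameter groups generated by x∂ₓ − d∂ᵤ and t∂ₜ − ∂ᵤ.) -/
/-- Case 1 of Table 2: for `f = c₁·exp(u)·x^(2+d)`, `g = c₂·exp(u)·x^(2+d)` on `x > 0`,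
solutions are mapped to solutions by the one-parameter groups generated by
`x·∂ₓ − d·∂ᵤ` and `t·∂ₜ − ∂ᵤ`. -/
theorem invariance_case1_2D
    (d c₁ c₂ ε : ℝ)
    (f g : ℝ → ℝ → ℝ)
    (hf : ∀ x w : ℝ, 0 < x → f x w = c₁ * Real.exp w * x ^ (2 + d))
    (hg : ∀ x w : ℝ, 0 < x → g x w = c₂ * Real.exp w * x ^ (2 + d))
    (u : ℝ → ℝ → ℝ) (hu : IsSolPos f g u) :
    IsSolPos f g (fun t x => u t (Real.exp (-ε) * x) - d * ε) ∧
    IsSolPos f g (fun t x => u (Real.exp (-ε) * t) x - ε) := by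
  obtain ⟨hs, he⟩ := hu
  refine ⟨⟨?_, fun t x hx => ?_⟩, ⟨?_, fun t x hx => ?_⟩⟩
  · have hφ : ContDiffOn ℝ (⊤ : ℕ∞) (fun p : ℝ × ℝ => (p.1, Real.exp (-ε) * p.2))
        {p : ℝ × ℝ | 0 < p.2} := by fun_prop
    exact (hs.comp hφ fun p hp => mul_pos (Real.exp_pos _) hp).sub contDiffOn_const
  · have hy : 0 < Real.exp (-ε) * x := mul_pos (Real.exp_pos _) hx
    have hd : ∀ y, deriv (fun z => u t (Real.exp (-ε) * z) - d * ε) y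
        = Real.exp (-ε) * deriv (fun z => u t z) (Real.exp (-ε) * y) := fun y => by
      rw [deriv_sub_const, deriv_comp_mul_left (Real.exp (-ε)) (fun z => u t z), smul_eq_mul]
    have hdd : deriv (deriv (fun z => u t (Real.exp (-ε) * z) - d * ε)) x
        = Real.exp (-ε) * (Real.exp (-ε) *
          deriv (deriv (fun z => u t z)) (Real.exp (-ε) * x)) := by
      rw [funext hd, deriv_const_mul_field,
        deriv_comp_mul_left (Real.exp (-ε)) (deriv fun z => u t z), smul_eq_mul]
    have hpow : (Real.exp (-ε) * x) ^ (2 + d)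
        = Real.exp (-ε) ^ 2 * Real.exp (-(d * ε)) * x ^ (2 + d) := by
      rw [Real.mul_rpow (Real.exp_pos _).le hx.le, ← Real.exp_mul, ← Real.exp_nat_mul,
        ← Real.exp_add]
      congr 2
      push_cast
      ring
    rw [deriv_sub_const, he t _ hy, hd, hdd, hf _ _ hy, hg _ _ hy, hf _ _ hx, hg _ _ hx, hpow]
    simp only [sub_eq_add_neg, Real.exp_add]
    ring
  · have hφ : ContDiffOn ℝ (⊤ : ℕ∞) (fun p : ℝ × ℝ => (Real.exp (-ε) * p.1, p.2))
        {p : ℝ × ℝ | 0 < p.2} := by fun_prop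
    exact (hs.comp hφ fun p hp => hp).sub contDiffOn_const
  · have hd : deriv (fun y => u (Real.exp (-ε) * t) y - ε)
        = deriv (fun y => u (Real.exp (-ε) * t) y) := funext fun y => by rw [deriv_sub_const]
    rw [deriv_sub_const, deriv_comp_mul_left (Real.exp (-ε)) (fun s => u s x), smul_eq_mul,
      he _ x hx, hd, hf _ _ hx, hg _ _ hx, hf _ _ hx, hg _ _ hx]
    simp only [sub_eq_add_neg, Real.exp_add]
    ring
end

section
/- Let a, c₁, c₂, ε ∈ ℝ. Define f(x,w) := c₁·(w + x)^{1−a} and g(x,w) := c₂·(w + x)^{2−a} (real powers of a positive base). Let u : ℝ × ℝ → ℝ be smooth with u(t,x) + x > 0 for all (t,x), and suppose u is a solution of E(f,g). Then v₁(t,x) := e^{ε}·u(e^{−aε}·t, e^{−ε}·x) satisfies v₁(t,x) + x > 0 for all (t,x) and is a solution of E(f,g), and v₂(t,x) := u(t, x − ε) − ε satisfies v₂(t,x) + x > 0 for all (t,x) and is a solution of E(f,g). (Invariance under the one-parameter groups generated by at∂ₜ + x∂ₓ + u∂ᵤ and ∂ₓ − ∂ᵤ.) -/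
/-- Case 2 of Table 2: for `f = c₁·(u + x)^(1−a)`, `g = c₂·(u + x)^(2−a)` on the region
`u + x > 0`, solutions are mapped to solutions by the one-parameter groups generated by
`a·t·∂ₜ + x·∂ₓ + u·∂ᵤ` and `∂ₓ − ∂ᵤ`. -/
theorem invariance_case2_2D
    (a c₁ c₂ ε : ℝ)
    (f g : ℝ → ℝ → ℝ)
    (hf : ∀ x w : ℝ, f x w = c₁ * (w + x) ^ (1 - a))
    (hg : ∀ x w : ℝ, g x w = c₂ * (w + x) ^ (2 - a))
    (u : ℝ → ℝ → ℝ) (hpos : ∀ t x : ℝ, 0 < u t x + x) (hu : IsSol f g u) :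
    (∀ t x : ℝ, 0 < Real.exp ε * u (Real.exp (-(a * ε)) * t) (Real.exp (-ε) * x) + x) ∧
    IsSol f g (fun t x => Real.exp ε * u (Real.exp (-(a * ε)) * t) (Real.exp (-ε) * x)) ∧
    (∀ t x : ℝ, 0 < u t (x - ε) - ε + x) ∧
    IsSol f g (fun t x => u t (x - ε) - ε) := by
  obtain ⟨hsmooth, hpde⟩ := hu
  have hscale : ∀ t x : ℝ,
      Real.exp ε * u t (Real.exp (-ε) * x) + x
        = Real.exp ε * (u t (Real.exp (-ε) * x) + Real.exp (-ε) * x) := by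
    intro t x
    rw [mul_add, ← mul_assoc (Real.exp ε) (Real.exp (-ε)), ← Real.exp_add]
    simp
  refine ⟨fun t x => ?_, ⟨?_, fun t x => ?_⟩, fun t x => ?_, ⟨?_, fun t x => ?_⟩⟩
  · rw [hscale]
    exact mul_pos (Real.exp_pos _) (hpos _ _)
  · have hcoord : ContDiff ℝ (⊤ : ℕ∞)
        (fun p : ℝ × ℝ => (Real.exp (-(a * ε)) * p.1, Real.exp (-ε) * p.2)) := by
      fun_prop
    exact contDiff_const.mul (hsmooth.comp hcoord)
  · have hx : deriv (fun y => Real.exp ε * u (Real.exp (-(a * ε)) * t) (Real.exp (-ε) * y))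
        = fun y => deriv (fun z => u (Real.exp (-(a * ε)) * t) z) (Real.exp (-ε) * y) := by
      funext y
      rw [deriv_const_mul_field,
        deriv_comp_mul_left (Real.exp (-ε)) (fun z => u (Real.exp (-(a * ε)) * t) z) y,
        smul_eq_mul, ← mul_assoc, ← Real.exp_add]
      simp
    have ht : deriv (fun s => Real.exp ε * u (Real.exp (-(a * ε)) * s) (Real.exp (-ε) * x)) t
        = Real.exp ε * (Real.exp (-(a * ε))
          * deriv (fun s => u s (Real.exp (-ε) * x)) (Real.exp (-(a * ε)) * t)) := by
      rw [deriv_const_mul_field,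
        deriv_comp_mul_left (Real.exp (-(a * ε))) (fun s => u s (Real.exp (-ε) * x)) t,
        smul_eq_mul]
    have hf_exp : Real.exp ε ^ (1 - a) = Real.exp ε * Real.exp (-(a * ε)) := by
      rw [← Real.exp_mul, ← Real.exp_add]
      ring_nf
    have hg_exp : Real.exp ε ^ (2 - a) * Real.exp (-ε) = Real.exp ε * Real.exp (-(a * ε)) := by
      rw [← Real.exp_mul, ← Real.exp_add, ← Real.exp_add]
      ring_nf
    simp only [hx, ht]
    rw [deriv_comp_mul_left (Real.exp (-ε))
        (deriv (fun z => u (Real.exp (-(a * ε)) * t) z)) x, smul_eq_mul,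
      hpde, hf, hg, hf, hg, hscale,
      Real.mul_rpow (Real.exp_pos _).le (hpos _ _).le,
      Real.mul_rpow (Real.exp_pos _).le (hpos _ _).le, hf_exp]
    linear_combination (-(c₂ * (u (Real.exp (-(a * ε)) * t) (Real.exp (-ε) * x)
      + Real.exp (-ε) * x) ^ (2 - a)
      * deriv (deriv (fun z => u (Real.exp (-(a * ε)) * t) z)) (Real.exp (-ε) * x))) * hg_exp
  · linarith [hpos t (x - ε)]
  · have hcoord : ContDiff ℝ (⊤ : ℕ∞) (fun p : ℝ × ℝ => (p.1, p.2 - ε)) := by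
      fun_prop
    exact (hsmooth.comp hcoord).sub contDiff_const
  · have hx : deriv (fun y => u t (y - ε) - ε) = fun y => deriv (fun z => u t z) (y - ε) := by
      funext y
      rw [deriv_sub_const, deriv_comp_sub_const (f := fun z => u t z)]
    have hsum : u t (x - ε) - ε + x = u t (x - ε) + (x - ε) := by ring
    simp only [hx]
    rw [deriv_sub_const, deriv_comp_sub_const (f := deriv (fun z => u t z)), hpde, hf, hg, hf, hg,
      hsum]
end

section
/- Let a, c₁, c₂, ε ∈ ℝ. Define f(x,w) := c₁·e^{(2−a)w} and g(x,w) := c₂·e^{(2−a)w}. If u is a solution of E(f,g), then both v₁(t,x) := u(e^{−aε}·t, e^{−ε}·x) + ε and v₂(t,x) := u(t, x − ε) are solutions of E(f,g). (Invariance under the one-parameter groups generated by at∂ₜ + x∂ₓ + ∂ᵤ and ∂ₓ.) -/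
/-- Case 3a of Table 2: for `f = c₁·exp((2−a)·u)`, `g = c₂·exp((2−a)·u)`, solutions are
mapped to solutions by the one-parameter groups generated by `a·t·∂ₜ + x·∂ₓ + ∂ᵤ`
and `∂ₓ`. -/
theorem invariance_case3a_2D
    (a c₁ c₂ ε : ℝ)
    (f g : ℝ → ℝ → ℝ)
    (hf : ∀ x w : ℝ, f x w = c₁ * Real.exp ((2 - a) * w))
    (hg : ∀ x w : ℝ, g x w = c₂ * Real.exp ((2 - a) * w))
    (u : ℝ → ℝ → ℝ) (hu : IsSol f g u) :
    IsSol f g (fun t x => u (Real.exp (-(a * ε)) * t) (Real.exp (-ε) * x) + ε) ∧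
    IsSol f g (fun t x => u t (x - ε)) := by
  obtain ⟨hsmooth, heq⟩ := hu
  refine ⟨⟨?_, fun t x => ?_⟩, ⟨?_, fun t x => ?_⟩⟩
  · have h : ContDiff ℝ (⊤ : ℕ∞)
        (fun p : ℝ × ℝ => (Real.exp (-(a * ε)) * p.1, Real.exp (-ε) * p.2)) := by fun_prop
    exact (hsmooth.comp h).add contDiff_const
  · have hx : deriv (fun y => u (Real.exp (-(a * ε)) * t) (Real.exp (-ε) * y) + ε)
        = fun y => Real.exp (-ε) *
          deriv (fun z => u (Real.exp (-(a * ε)) * t) z) (Real.exp (-ε) * y) := by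
      funext y
      rw [deriv_add_const,
        deriv_comp_mul_left (Real.exp (-ε)) (fun z => u (Real.exp (-(a * ε)) * t) z) y,
        smul_eq_mul]
    have hscale : Real.exp (-(a * ε)) = Real.exp ((2 - a) * ε) * Real.exp (-ε) ^ 2 := by
      rw [← Real.exp_nat_mul, ← Real.exp_add]
      congr 1
      push_cast
      ring
    have h := heq (Real.exp (-(a * ε)) * t) (Real.exp (-ε) * x)
    rw [hf, hg] at h
    rw [hx, deriv_const_mul_field,
      deriv_comp_mul_left (Real.exp (-ε))
        (deriv fun z => u (Real.exp (-(a * ε)) * t) z) x,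
      deriv_add_const,
      deriv_comp_mul_left (Real.exp (-(a * ε))) (fun s => u s (Real.exp (-ε) * x)) t,
      smul_eq_mul, smul_eq_mul, h, hf, hg, mul_add (2 - a), Real.exp_add]
    linear_combination (c₁ * Real.exp ((2 - a) * u (Real.exp (-(a * ε)) * t) (Real.exp (-ε) * x)) *
      deriv (fun z => u (Real.exp (-(a * ε)) * t) z) (Real.exp (-ε) * x) ^ 2 +
      c₂ * Real.exp ((2 - a) * u (Real.exp (-(a * ε)) * t) (Real.exp (-ε) * x)) *
      deriv (deriv fun z => u (Real.exp (-(a * ε)) * t) z) (Real.exp (-ε) * x)) * hscale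
  · have h : ContDiff ℝ (⊤ : ℕ∞) (fun p : ℝ × ℝ => (p.1, p.2 - ε)) := by fun_prop
    exact hsmooth.comp h
  · have hx : deriv (fun y => u t (y - ε)) = fun y => deriv (fun z => u t z) (y - ε) := by
      funext y
      exact deriv_comp_sub_const (fun z => u t z) ε y
    have h := heq t (x - ε)
    rw [hf, hg] at h
    rw [hx, deriv_comp_sub_const (deriv fun z => u t z) ε x, hf, hg, h]
end

section
/- Let c₁, c₂, ε ∈ ℝ. Define f(x,w) := c₁·e^{w+x} and g(x,w) := c₂·e^{w+x}. If u is a solution of E(f,g), then both v₁(t,x) := u(e^{−ε}·t, x) − ε and v₂(t,x) := u(t, x − ε) − ε are solutions of E(f,g). (Invariance under the one-parameter groups generated by t∂ₜ − ∂ᵤ and ∂ₓ − ∂ᵤ.) -/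
/-- Case 4 of Table 2: for `f = c₁·exp(u + x)`, `g = c₂·exp(u + x)`, solutions are
mapped to solutions by the one-parameter groups generated by `t·∂ₜ − ∂ᵤ` and
`∂ₓ − ∂ᵤ`. -/
theorem invariance_case4_2D
    (c₁ c₂ ε : ℝ)
    (f g : ℝ → ℝ → ℝ)
    (hf : ∀ x w : ℝ, f x w = c₁ * Real.exp (w + x))
    (hg : ∀ x w : ℝ, g x w = c₂ * Real.exp (w + x))
    (u : ℝ → ℝ → ℝ) (hu : IsSol f g u) :
    IsSol f g (fun t x => u (Real.exp (-ε) * t) x - ε) ∧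
    IsSol f g (fun t x => u t (x - ε) - ε) := by
  obtain ⟨hsmooth, heq⟩ := hu
  refine ⟨⟨?_, fun t x => ?_⟩, ⟨?_, fun t x => ?_⟩⟩
  · have h : ContDiff ℝ (⊤ : ℕ∞) (fun p : ℝ × ℝ => (Real.exp (-ε) * p.1, p.2)) := by fun_prop
    exact (hsmooth.comp h).sub contDiff_const
  · have hexp : Real.exp (u (Real.exp (-ε) * t) x - ε + x)
        = Real.exp (-ε) * Real.exp (u (Real.exp (-ε) * t) x + x) := by
      rw [← Real.exp_add]
      ring_nf
    have ht : deriv (fun s => u (Real.exp (-ε) * s) x) t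
        = Real.exp (-ε) * deriv (fun s => u s x) (Real.exp (-ε) * t) := by
      simpa using deriv_comp_mul_left (Real.exp (-ε)) (fun s => u s x) t
    have hpde := heq (Real.exp (-ε) * t) x
    simp only [deriv_sub_const_fun, hf, hg] at hpde ⊢
    rw [ht, hpde, hexp]
    ring
  · have h : ContDiff ℝ (⊤ : ℕ∞) (fun p : ℝ × ℝ => (p.1, p.2 - ε)) := by fun_prop
    exact (hsmooth.comp h).sub contDiff_const
  · have hexp : u t (x - ε) - ε + x = u t (x - ε) + (x - ε) := by ring
    have hx : deriv (fun y => u t (y - ε)) = fun y => deriv (fun z => u t z) (y - ε) :=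
      funext fun y => deriv_comp_sub_const (fun z => u t z) ε y
    have hxx : deriv (fun y => deriv (fun z => u t z) (y - ε)) x
        = deriv (deriv (fun z => u t z)) (x - ε) :=
      deriv_comp_sub_const (deriv (fun z => u t z)) ε x
    have hpde := heq t (x - ε)
    simp only [hx, hxx, deriv_sub_const_fun, hf, hg, hexp] at hpde ⊢
    exact hpde
end

section
/- Let a, b, c₁, c₂, ε ∈ ℝ. Define f(x,w) := c₁·x^{2−a−b} and g(x,w) := c₂·x^{2−a} for x > 0 (real powers of a positive base). If u is a solution of E(f,g) on ℝ × (0,∞), then both v₁(t,x) := e^{bε}·u(e^{−aε}·t, e^{−ε}·x) and v₂(t,x) := u(t,x) + ε are solutions of E(f,g) on ℝ × (0,∞). (Invariance under the one-parameter groups generated by at∂ₜ + x∂ₓ + bu∂ᵤ and ∂ᵤ.) -/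
/-- Case 5 of Table 2: for `f = c₁·x^(2−a−b)`, `g = c₂·x^(2−a)` on `x > 0`, solutions
are mapped to solutions by the one-parameter groups generated by
`a·t·∂ₜ + x·∂ₓ + b·u·∂ᵤ` and `∂ᵤ`. -/
theorem invariance_case5_2D
    (a b c₁ c₂ ε : ℝ)
    (f g : ℝ → ℝ → ℝ)
    (hf : ∀ x w : ℝ, 0 < x → f x w = c₁ * x ^ (2 - a - b))
    (hg : ∀ x w : ℝ, 0 < x → g x w = c₂ * x ^ (2 - a))
    (u : ℝ → ℝ → ℝ) (hu : IsSolPos f g u) :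
    IsSolPos f g (fun t x => Real.exp (b * ε) * u (Real.exp (-(a * ε)) * t) (Real.exp (-ε) * x)) ∧
    IsSolPos f g (fun t x => u t x + ε) := by
  obtain ⟨hsm, heq⟩ := hu
  refine ⟨⟨?_, ?_⟩, ⟨hsm.add contDiffOn_const, ?_⟩⟩
  · refine contDiffOn_const.mul (hsm.comp (g := fun p : ℝ × ℝ => u p.1 p.2)
      (f := fun p : ℝ × ℝ => (Real.exp (-(a * ε)) * p.1, Real.exp (-ε) * p.2)) ?_ ?_)
    · exact ContDiff.contDiffOn (by fun_prop)
    · intro p hp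
      exact mul_pos (Real.exp_pos _) hp
  · intro t x hx
    have hy : 0 < Real.exp (-ε) * x := mul_pos (Real.exp_pos _) hx
    have deriv_t : deriv (fun s => Real.exp (b * ε) * u (Real.exp (-(a * ε)) * s)
        (Real.exp (-ε) * x)) t = Real.exp (b * ε) * (Real.exp (-(a * ε)) *
          deriv (fun s => u s (Real.exp (-ε) * x)) (Real.exp (-(a * ε)) * t)) := by
      rw [deriv_const_mul_field, deriv_comp_mul_left (Real.exp (-(a * ε)))
        (fun s => u s (Real.exp (-ε) * x)), smul_eq_mul]
    have deriv_x : deriv (fun y => Real.exp (b * ε) * u (Real.exp (-(a * ε)) * t)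
        (Real.exp (-ε) * y)) = fun y => Real.exp (b * ε) * (Real.exp (-ε) *
          deriv (fun z => u (Real.exp (-(a * ε)) * t) z) (Real.exp (-ε) * y)) := by
      funext y
      rw [deriv_const_mul_field, deriv_comp_mul_left (Real.exp (-ε))
        (fun z => u (Real.exp (-(a * ε)) * t) z), smul_eq_mul]
    have deriv_xx := deriv_comp_mul_left (Real.exp (-ε))
      (deriv (fun z => u (Real.exp (-(a * ε)) * t) z)) x
    have rpow_scale (p : ℝ) : (Real.exp (-ε) * x) ^ p = Real.exp (-ε * p) * x ^ p := by
      rw [Real.mul_rpow (Real.exp_pos _).le hx.le, ← Real.exp_mul]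
    have exp_f : Real.exp (b * ε) * Real.exp (-(a * ε)) * Real.exp (-ε * (2 - a - b)) =
        (Real.exp (b * ε) * Real.exp (-ε)) ^ 2 := by
      rw [sq]
      simp only [← Real.exp_add]
      ring_nf
    have exp_g : Real.exp (-(a * ε)) * Real.exp (-ε * (2 - a)) = Real.exp (-ε) ^ 2 := by
      rw [sq]
      simp only [← Real.exp_add]
      ring_nf
    beta_reduce
    rw [deriv_t, deriv_x, heq _ _ hy, deriv_const_mul_field, deriv_const_mul_field, deriv_xx,
      smul_eq_mul, hf _ _ hx, hg _ _ hx, hf _ _ hy, hg _ _ hy, rpow_scale, rpow_scale]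
    beta_reduce
    generalize deriv (deriv (fun z => u (Real.exp (-(a * ε)) * t) z)) (Real.exp (-ε) * x) = w₂
    generalize deriv (fun z => u (Real.exp (-(a * ε)) * t) z) (Real.exp (-ε) * x) = w₁
    linear_combination c₁ * x ^ (2 - a - b) * w₁ ^ 2 * exp_f +
      Real.exp (b * ε) * c₂ * x ^ (2 - a) * w₂ * exp_g
  · intro t x hx
    have deriv_x : deriv (fun y => u t y + ε) = deriv (fun y => u t y) :=
      funext fun y => deriv_add_const ε
    beta_reduce
    rw [deriv_x, deriv_add_const, heq t x hx, hf _ _ hx, hg _ _ hx, hf _ _ hx, hg _ _ hx]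
end

section
/- Let b, c₁, c₂, ε ∈ ℝ. Define f(x,w) := c₁·e^{(1+b)x} and g(x,w) := c₂·e^{x}. If u is a solution of E(f,g), then both v₁(t,x) := e^{bε}·u(e^{−ε}·t, x + ε) and v₂(t,x) := u(t,x) + ε are solutions of E(f,g). (Invariance under the one-parameter groups generated by t∂ₜ − ∂ₓ + bu∂ᵤ and ∂ᵤ; the second requires b arbitrary since f, g do not depend on u.) -/
/-- Case 6 of Table 2: for `f = c₁·exp((1+b)·x)`, `g = c₂·exp(x)`, solutions are mapped
to solutions by the one-parameter groups generated by `t·∂ₜ − ∂ₓ + b·u·∂ᵤ` and `∂ᵤ`. -/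
theorem invariance_case6_2D
    (b c₁ c₂ ε : ℝ)
    (f g : ℝ → ℝ → ℝ)
    (hf : ∀ x w : ℝ, f x w = c₁ * Real.exp ((1 + b) * x))
    (hg : ∀ x w : ℝ, g x w = c₂ * Real.exp x)
    (u : ℝ → ℝ → ℝ) (hu : IsSol f g u) :
    IsSol f g (fun t x => Real.exp (b * ε) * u (Real.exp (-ε) * t) (x + ε)) ∧
    IsSol f g (fun t x => u t x + ε) := by
  obtain ⟨hsmooth, heq⟩ := hu
  refine ⟨⟨?_, fun t x => ?_⟩, ⟨hsmooth.add contDiff_const, fun t x => ?_⟩⟩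
  · have hshift : ContDiff ℝ (⊤ : ℕ∞)
        (fun p : ℝ × ℝ => (Real.exp (-ε) * p.1, p.2 + ε)) := by fun_prop
    exact contDiff_const.mul (hsmooth.comp hshift)
  · have ht : deriv (fun s => Real.exp (b * ε) * u (Real.exp (-ε) * s) (x + ε)) t
        = Real.exp (b * ε) * (Real.exp (-ε) *
          deriv (fun s => u s (x + ε)) (Real.exp (-ε) * t)) := by
      rw [deriv_const_mul_field,
        deriv_comp_mul_left (Real.exp (-ε)) (fun s => u s (x + ε)) t, smul_eq_mul]
    have hx : deriv (fun y => Real.exp (b * ε) * u (Real.exp (-ε) * t) (y + ε))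
        = fun y => Real.exp (b * ε) * deriv (fun z => u (Real.exp (-ε) * t) z) (y + ε) := by
      funext y
      rw [deriv_const_mul_field, deriv_comp_add_const (fun z => u (Real.exp (-ε) * t) z) ε y]
    have hxx : deriv (fun y => Real.exp (b * ε) *
          deriv (fun z => u (Real.exp (-ε) * t) z) (y + ε)) x
        = Real.exp (b * ε) * deriv (deriv (fun z => u (Real.exp (-ε) * t) z)) (x + ε) := by
      rw [deriv_const_mul_field,
        deriv_comp_add_const (deriv fun z => u (Real.exp (-ε) * t) z) ε x]
    have hexp₁ : Real.exp (b * ε) * Real.exp (-ε) * Real.exp ((1 + b) * (x + ε))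
        = Real.exp ((1 + b) * x) * Real.exp (b * ε) ^ 2 := by
      rw [sq, ← Real.exp_add, ← Real.exp_add, ← Real.exp_add, ← Real.exp_add]
      ring_nf
    have hexp₂ : Real.exp (-ε) * Real.exp (x + ε) = Real.exp x := by
      rw [← Real.exp_add]
      ring_nf
    beta_reduce
    rw [ht, hx, hxx, heq, hf, hg, hf, hg]
    linear_combination
      c₁ * deriv (fun z => u (Real.exp (-ε) * t) z) (x + ε) ^ 2 * hexp₁
        + c₂ * Real.exp (b * ε)
          * deriv (deriv (fun z => u (Real.exp (-ε) * t) z)) (x + ε) * hexp₂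
  · have hx : deriv (fun y => u t y + ε) = deriv (fun y => u t y) := by
      funext y
      rw [deriv_add_const]
    beta_reduce
    rw [hx, deriv_add_const, heq, hf, hg, hf, hg]
end

section
/- Let c₁, c₂, ε ∈ ℝ. Define f(x,w) := c₁·e^{x} and g(x,w) := c₂. If u is a solution of E(f,g), then both v₁(t,x) := e^{−ε}·u(t, x − ε) and v₂(t,x) := u(t,x) + ε are solutions of E(f,g). (Invariance under the one-parameter groups generated by ∂ₓ − u∂ᵤ and ∂ᵤ.) -/
/-- Case 7 of Table 2: for `f = c₁·exp(x)`, `g = c₂`, solutions are mapped to solutions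
by the one-parameter groups generated by `∂ₓ − u·∂ᵤ` and `∂ᵤ`. -/
theorem invariance_case7_2D
    (c₁ c₂ ε : ℝ)
    (f g : ℝ → ℝ → ℝ)
    (hf : ∀ x w : ℝ, f x w = c₁ * Real.exp x)
    (hg : ∀ x w : ℝ, g x w = c₂)
    (u : ℝ → ℝ → ℝ) (hu : IsSol f g u) :
    IsSol f g (fun t x => Real.exp (-ε) * u t (x - ε)) ∧
    IsSol f g (fun t x => u t x + ε) := by
  obtain ⟨hsmooth, heq⟩ := hu
  simp only [hf, hg] at heq
  refine ⟨⟨?_, fun t x => ?_⟩, ⟨hsmooth.add contDiff_const, fun t x => ?_⟩⟩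
  · have hshift : ContDiff ℝ (⊤ : ℕ∞) (fun p : ℝ × ℝ => (p.1, p.2 - ε)) := by fun_prop
    exact contDiff_const.mul (hsmooth.comp hshift)
  · have hx : deriv (fun y => Real.exp (-ε) * u t (y - ε))
        = fun y => Real.exp (-ε) * deriv (fun z => u t z) (y - ε) := by
      funext y
      rw [deriv_const_mul_field, deriv_comp_sub_const (f := fun z => u t z)]
    have hxx : deriv (fun y => Real.exp (-ε) * deriv (fun z => u t z) (y - ε)) x
        = Real.exp (-ε) * deriv (deriv (fun z => u t z)) (x - ε) := by
      rw [deriv_const_mul_field, deriv_comp_sub_const (f := deriv (fun z => u t z))]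
    simp only [hf, hg, hx, hxx]
    rw [deriv_const_mul_field, heq]
    rw [sub_eq_add_neg x ε, Real.exp_add]
    ring
  · have hx : deriv (fun y => u t y + ε) = deriv (fun y => u t y) :=
      funext fun y => deriv_add_const ε
    simp only [hf, hg, hx, deriv_add_const, heq]
end

section
/- Let c, ε ∈ ℝ. Define f(x,w) := c·e^{w} and g(x,w) := e^{w}. If u is a solution of E(f,g), then each of the functions v₁(t,x) := u(t, e^{−ε}·x) + 2ε, v₂(t,x) := u(t, x − ε), and v₃(t,x) := u(e^{−ε}·t, x) − ε is a solution of E(f,g). (Invariance under the one-parameter groups generated by x∂ₓ + 2∂ᵤ, ∂ₓ, and t∂ₜ − ∂ᵤ.) -/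
/-- Case 1 of Table 3: for `f = c·exp(u)`, `g = exp(u)`, solutions are mapped to
solutions by the one-parameter groups generated by `x·∂ₓ + 2·∂ᵤ`, `∂ₓ` and
`t·∂ₜ − ∂ᵤ`. -/
theorem invariance_case1_34D
    (c ε : ℝ)
    (f g : ℝ → ℝ → ℝ)
    (hf : ∀ x w : ℝ, f x w = c * Real.exp w)
    (hg : ∀ x w : ℝ, g x w = Real.exp w)
    (u : ℝ → ℝ → ℝ) (hu : IsSol f g u) :
    IsSol f g (fun t x => u t (Real.exp (-ε) * x) + 2 * ε) ∧
    IsSol f g (fun t x => u t (x - ε)) ∧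
    IsSol f g (fun t x => u (Real.exp (-ε) * t) x - ε) := by
  obtain ⟨hc, he⟩ := hu
  simp only [hf, hg] at he
  have comp (a b : ℝ → ℝ) (ha : ContDiff ℝ (⊤ : ℕ∞) a) (hb : ContDiff ℝ (⊤ : ℕ∞) b) :
      ContDiff ℝ (⊤ : ℕ∞) (fun p : ℝ × ℝ => u (a p.1) (b p.2)) :=
    hc.comp ((ha.comp contDiff_fst).prodMk (hb.comp contDiff_snd))
  refine ⟨⟨?_, fun t x => ?_⟩, ⟨?_, fun t x => ?_⟩, ⟨?_, fun t x => ?_⟩⟩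
  · exact (comp (fun t => t) (fun x => Real.exp (-ε) * x) (by fun_prop) (by fun_prop)).add
      contDiff_const
  · have hx : deriv (fun y => u t (Real.exp (-ε) * y) + 2 * ε)
        = fun y => Real.exp (-ε) * deriv (fun z => u t z) (Real.exp (-ε) * y) := by
      funext y
      rw [deriv_add_const]
      exact deriv_comp_mul_left (Real.exp (-ε)) (fun z => u t z) y
    have hxx : deriv (fun y => Real.exp (-ε) * deriv (fun z => u t z) (Real.exp (-ε) * y)) x
        = Real.exp (-ε) * (Real.exp (-ε) *
          deriv (deriv (fun z => u t z)) (Real.exp (-ε) * x)) := by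
      rw [deriv_const_mul_field]
      congr 1
      exact deriv_comp_mul_left (Real.exp (-ε)) (deriv (fun z => u t z)) x
    have hexp : Real.exp (2 * ε) * (Real.exp (-ε) * Real.exp (-ε)) = 1 := by
      rw [← Real.exp_add, ← Real.exp_add]
      simp [two_mul]
    simp only [hf, hg]
    rw [hx, hxx, deriv_add_const, he, Real.exp_add]
    linear_combination (-(c * Real.exp (u t (Real.exp (-ε) * x))
      * (deriv (fun z => u t z) (Real.exp (-ε) * x)) ^ 2
      + Real.exp (u t (Real.exp (-ε) * x))
      * deriv (deriv (fun z => u t z)) (Real.exp (-ε) * x))) * hexp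
  · exact comp (fun t => t) (fun x => x - ε) (by fun_prop) (by fun_prop)
  · have hx : deriv (fun y => u t (y - ε)) = fun y => deriv (fun z => u t z) (y - ε) := by
      funext y
      exact deriv_comp_sub_const (fun z => u t z) ε y
    simp only [hf, hg]
    rw [hx, he, deriv_comp_sub_const (deriv (fun z => u t z)) ε x]
  · exact (comp (fun t => Real.exp (-ε) * t) (fun x => x) (by fun_prop) (by fun_prop)).sub
      contDiff_const
  · have ht : deriv (fun s => u (Real.exp (-ε) * s) x - ε) t
        = Real.exp (-ε) * deriv (fun s => u s x) (Real.exp (-ε) * t) := by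
      rw [deriv_sub_const]
      exact deriv_comp_mul_left (Real.exp (-ε)) (fun s => u s x) t
    have hx : deriv (fun y => u (Real.exp (-ε) * t) y - ε)
        = deriv (fun y => u (Real.exp (-ε) * t) y) := by
      funext y
      exact deriv_sub_const ε
    simp only [hf, hg]
    rw [ht, hx, he, sub_eq_add_neg, Real.exp_add]
    ring
end
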